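/- Let α > 0. Then √α·{(γ − log(2πα))/(2α) + ∑_{n=1}^∞ φ(nα)} = −(1/π^{3/2}) ∫_0^∞ Ξ(t/2)²·Γ((−1+it)/4)·Γ((−1−it)/4)·cos((t/2)·log α)/(1+t²) dt. -/

import Mathlib

noncomputable section
open Complex MeasureTheory Set Filter Topology

/-- Digamma function `ψ = Γ'/Γ`. -/
def digam (x : ℝ) : ℝ := deriv Real.Gamma x / Real.Gamma x

/-- `φ(x) = ψ(x) + 1/(2x) - log x`. -/
def phi (x : ℝ) : ℝ := digam x + 1 / (2 * x) - Real.log x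

/-- The Riemann xi function. -/
def RiemannXi (s : ℂ) : ℂ :=
  (1/2) * s * (s - 1) * (Real.pi : ℂ) ^ (-s / 2) * Complex.Gamma (s / 2) * riemannZeta s

/-- The Riemann Xi function `Ξ(t) = ξ(1/2 + it)`. -/
def RiemannBigXi (t : ℂ) : ℂ := RiemannXi (1 / 2 + I * t)

def ee (t : ℝ) : ℝ := (Real.exp t - 1)⁻¹
def kk (t : ℝ) : ℝ := ee t - t⁻¹

lemma expm1_pos {t : ℝ} (ht : 0 < t) : 0 < Real.exp t - 1 := by
  have := Real.add_one_lt_exp ht.ne'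
  linarith

lemma ee_pos {t : ℝ} (ht : 0 < t) : 0 < ee t := inv_pos.mpr (expm1_pos ht)

lemma kk_nonpos {t : ℝ} (ht : 0 < t) : kk t ≤ 0 := by
  unfold kk ee
  have := Real.add_one_le_exp t
  have := inv_anti₀ ht (by linarith : t ≤ Real.exp t - 1)
  linarith

lemma pade {t : ℝ} (ht : 0 < t) : 2 * (Real.exp t - 1) ≤ t * (Real.exp t + 1) := by
  have hd : ∀ x : ℝ, HasDerivAt (fun x => x * (Real.exp x + 1) - 2 * (Real.exp x - 1))
      (1 * (Real.exp x + 1) + x * Real.exp x - 2 * Real.exp x) x := by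
    intro x
    exact ((hasDerivAt_id x).mul ((Real.hasDerivAt_exp x).add_const 1)).sub
      (((Real.hasDerivAt_exp x).sub_const 1).const_mul 2)
  have hm : Monotone (fun x => x * (Real.exp x + 1) - 2 * (Real.exp x - 1)) := by
    apply monotone_of_deriv_nonneg (fun x => (hd x).differentiableAt)
    intro x
    rw [(hd x).deriv]
    have h1 := Real.add_one_le_exp (-x)
    have h2 := Real.exp_pos x
    have h3 : Real.exp (-x) * Real.exp x = 1 := by rw [← Real.exp_add]; simp
    nlinarith
  have := hm ht.le
  simp at this
  linarith

lemma kk_ge {t : ℝ} (ht : 0 < t) : -(1/2) ≤ kk t := by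
  unfold kk ee
  have h1 := expm1_pos ht
  have h2 := pade ht
  have : (Real.exp t - 1)⁻¹ - t⁻¹ + 1/2 = (t * (Real.exp t + 1) - 2 * (Real.exp t - 1)) / (2 * t * (Real.exp t - 1)) := by
    field_simp
    ring
  have h3 : 0 ≤ (t * (Real.exp t + 1) - 2 * (Real.exp t - 1)) / (2 * t * (Real.exp t - 1)) :=
    div_nonneg (by linarith) (by positivity)
  linarith

lemma kk_le {t : ℝ} (ht : 0 < t) : kk t + 1/2 ≤ t / 2 := by
  unfold kk ee
  have h1 := expm1_pos ht
  have h2 := Real.quadratic_le_exp_of_nonneg ht.le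
  have : t / 2 - ((Real.exp t - 1)⁻¹ - t⁻¹ + 1/2) = ((t^2 + 2 - t) * (Real.exp t - 1) - 2 * t) / (2 * t * (Real.exp t - 1)) := by
    field_simp
    ring
  have h3 : 0 ≤ ((t^2 + 2 - t) * (Real.exp t - 1) - 2 * t) / (2 * t * (Real.exp t - 1)) := by
    apply div_nonneg _ (by positivity)
    have h4 : 0 ≤ t^2 + 2 - t := by nlinarith [sq_nonneg (t - 1)]
    have h5 : t + t^2/2 ≤ Real.exp t - 1 := by linarith
    have := mul_le_mul_of_nonneg_left h5 h4
    nlinarith [pow_pos ht 3, pow_pos ht 4]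
  linarith

lemma kk_abs_inv {t : ℝ} (ht : 0 < t) : |kk t| ≤ t⁻¹ := by
  rw [abs_of_nonpos (kk_nonpos ht)]
  have := ee_pos ht
  unfold kk
  linarith

lemma kk_abs_half {t : ℝ} (ht : 0 < t) : |kk t| ≤ 1/2 := by
  rw [abs_of_nonpos (kk_nonpos ht)]
  linarith [kk_ge ht]

lemma kk_abs {t : ℝ} (ht : 0 < t) : |kk t| ≤ 2 / (1 + t) := by
  rcases le_total t 1 with h | h
  · refine (kk_abs_half ht).trans ?_
    rw [div_le_div_iff₀ (by norm_num) (by linarith)]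
    linarith
  · refine (kk_abs_inv ht).trans ?_
    rw [inv_eq_one_div, div_le_div_iff₀ (by linarith) (by linarith)]
    linarith

lemma ee_contOn : ContinuousOn ee (Ioi 0) := by
  unfold ee
  apply ContinuousOn.inv₀
  · fun_prop
  · intro x hx; exact (expm1_pos hx).ne'

lemma kk_contOn : ContinuousOn kk (Ioi 0) := by
  unfold kk
  refine ee_contOn.sub ?_
  exact continuousOn_inv₀.mono (fun x hx => (ne_of_gt hx : x ≠ 0))

lemma ee_meas : Measurable ee := by unfold ee; fun_prop
lemma kk_meas : Measurable kk := by unfold kk; exact ee_meas.sub measurable_inv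

def kd (t : ℝ) : ℝ := -(Real.exp t) * (ee t)^2 + (t^2)⁻¹

lemma kd_meas : Measurable kd := by unfold kd; have := ee_meas; fun_prop

lemma kk_hasDeriv {t : ℝ} (ht : 0 < t) : HasDerivAt kk (kd t) t := by
  have h1 := (((Real.hasDerivAt_exp t).sub_const 1).inv (expm1_pos ht).ne').sub (hasDerivAt_inv ht.ne')
  refine h1.congr_deriv ?_
  unfold kd ee
  field_simp
  ring

lemma kd_le_inv_sq {t : ℝ} (ht : 0 < t) : kd t ≤ (t^2)⁻¹ := by
  unfold kd
  have := Real.exp_pos t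
  nlinarith [sq_nonneg (ee t), mul_nonneg this.le (sq_nonneg (ee t))]

lemma kd_factor {t : ℝ} : kd t = (t⁻¹ - Real.exp (t/2) * ee t) * (t⁻¹ + Real.exp (t/2) * ee t) := by
  unfold kd
  have : Real.exp t = Real.exp (t/2) * Real.exp (t/2) := by rw [← Real.exp_add]; ring_nf
  rw [this]
  have : (t^2)⁻¹ = t⁻¹ * t⁻¹ := by rw [sq, mul_inv]
  rw [this]
  ring

lemma half_ee_le {t : ℝ} (ht : 0 < t) : Real.exp (t/2) * ee t ≤ t⁻¹ := by
  have h1 := Real.self_le_sinh_iff.mpr (by linarith : 0 ≤ t/2)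
  rw [Real.sinh_eq] at h1
  have h2 := expm1_pos ht
  unfold ee
  rw [← div_eq_mul_inv, inv_eq_one_div, div_le_div_iff₀ h2 ht]
  have h3 : Real.exp t = Real.exp (t/2) * Real.exp (t/2) := by rw [← Real.exp_add]; ring_nf
  have h4 : Real.exp (-(t/2)) * Real.exp (t/2) = 1 := by rw [← Real.exp_add]; simp
  rw [h3]
  nlinarith [Real.exp_pos (t/2)]

lemma kd_nonneg {t : ℝ} (ht : 0 < t) : 0 ≤ kd t := by
  rw [kd_factor]
  have := half_ee_le ht
  have := ee_pos ht
  apply mul_nonneg (by linarith)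
  positivity

lemma kd_le_inv {t : ℝ} (ht : 0 < t) : kd t ≤ t⁻¹ := by
  rw [kd_factor]
  have h1 := half_ee_le ht
  have h2 := ee_pos ht
  have h3 : 1 ≤ Real.exp (t/2) := Real.one_le_exp (by linarith)
  have h4 := kk_ge ht
  unfold kk at h4
  have h5 : t⁻¹ - Real.exp (t/2) * ee t ≤ 1/2 := by nlinarith
  have h6 : 0 < t⁻¹ := inv_pos.mpr ht
  have h7 : 0 < Real.exp (t/2) * ee t := by positivity
  calc _ ≤ (1/2) * (t⁻¹ + t⁻¹) := by
        apply mul_le_mul h5 (by linarith) (by linarith) (by norm_num)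
    _ = t⁻¹ := by ring

lemma ee_le_inv {t : ℝ} (ht : 0 < t) : ee t ≤ t⁻¹ := by
  have := kk_nonpos ht
  unfold kk at this
  linarith

lemma ee_le_exp {t : ℝ} (ht : 1 ≤ t) : ee t ≤ 2 * Real.exp (-t) := by
  unfold ee
  rw [Real.exp_neg]
  have h1 := Real.add_one_le_exp t
  rw [inv_eq_one_div, ← div_eq_mul_inv, div_le_div_iff₀ (by linarith) (by linarith)]
  linarith

lemma locInt_ofReal {f : ℝ → ℝ} (hf : ContinuousOn f (Ioi 0)) :
    LocallyIntegrableOn (fun t => (f t : ℂ)) (Ioi 0) :=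
  (continuous_ofReal.comp_continuousOn hf).locallyIntegrableOn measurableSet_Ioi

lemma ee_top : (fun t => (ee t : ℂ)) =O[atTop] (fun t => Real.exp (-1 * t)) := by
  refine Asymptotics.IsBigO.of_bound 2 ?_
  filter_upwards [eventually_ge_atTop 1] with t ht
  rw [norm_real, Real.norm_of_nonneg (ee_pos (by linarith)).le, Real.norm_of_nonneg (Real.exp_pos _).le]
  simpa using ee_le_exp ht

lemma ee_bot : (fun t => (ee t : ℂ)) =O[𝓝[>] 0] (fun t : ℝ => t ^ (-1 : ℝ)) := by
  refine Asymptotics.IsBigO.of_bound 1 ?_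
  filter_upwards [self_mem_nhdsWithin] with t ht
  have ht : 0 < t := ht
  rw [norm_real, Real.norm_of_nonneg (ee_pos ht).le, Real.rpow_neg_one, Real.norm_of_nonneg (inv_pos.mpr ht).le]
  simpa using ee_le_inv ht

lemma ee_mellinConv {s : ℂ} (hs : 1 < s.re) : MellinConvergent (fun t => (ee t : ℂ)) s :=
  mellinConvergent_of_isBigO_rpow_exp one_pos (locInt_ofReal ee_contOn) ee_top ee_bot hs

lemma ee_hasSum {t : ℝ} (ht : 0 < t) : HasSum (fun n : ℕ => Real.exp (-((n:ℝ)+1) * t)) (ee t) := by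
  have h1 : Real.exp (-t) < 1 := by simpa using ht
  have h2 := (hasSum_geometric_of_lt_one (Real.exp_pos (-t)).le h1).mul_left (Real.exp (-t))
  have h3 : Real.exp (-t) * (1 - Real.exp (-t))⁻¹ = ee t := by
    unfold ee
    rw [Real.exp_neg]
    have := expm1_pos ht
    have h5 := Real.exp_pos t
    have : 1 - (Real.exp t)⁻¹ ≠ 0 := by
      rw [← Real.exp_neg]; linarith
    field_simp
  rw [h3] at h2
  refine h2.congr_fun ?_ |> fun h => h
  intro n
  rw [← Real.exp_nat_mul, ← Real.exp_add]
  ring_nf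

lemma ee_mellin {s : ℂ} (hs : 1 < s.re) :
    mellin (fun t => (ee t : ℂ)) s = Complex.Gamma s * riemannZeta s := by
  have h := hasSum_mellin (a := fun _ : ℕ => (1:ℂ)) (p := fun n : ℕ => (n:ℝ) + 1)
    (F := fun t => (ee t : ℂ)) (s := s) (fun i => Or.inr (by positivity)) (by linarith) ?_ ?_
  · rw [← h.tsum_eq, zeta_eq_tsum_one_div_nat_add_one_cpow hs, ← tsum_mul_left]
    congr 1
    ext n
    push_cast
    ring
  · intro t ht
    have := (ee_hasSum ht)
    have := Complex.hasSum_ofReal.mpr this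
    simpa using this
  · simp only [norm_one]
    have := (summable_nat_add_iff 1).mpr (Real.summable_one_div_nat_rpow.mpr hs)
    simpa using this

def mm (t : ℝ) : ℂ := (ee t : ℂ) - indicator (Ioc 0 1) (fun t : ℝ => (t:ℂ) ^ (-1 : ℂ)) t

lemma mm_locInt : LocallyIntegrableOn mm (Ioi 0) := by
  unfold mm
  refine (locInt_ofReal ee_contOn).sub ?_
  have : LocallyIntegrableOn (fun t : ℝ => (t:ℂ) ^ (-1 : ℂ)) (Ioi 0) := by
    refine ContinuousOn.locallyIntegrableOn ?_ measurableSet_Ioi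
    intro t ht
    exact (continuousAt_ofReal_cpow_const _ _ (Or.inr (ne_of_gt ht))).continuousWithinAt
  intro x hx
  obtain ⟨u, hu, hi⟩ := this x hx
  exact ⟨u, hu, hi.indicator measurableSet_Ioc⟩

lemma mm_top : mm =O[atTop] (fun t => Real.exp (-1 * t)) := by
  refine ee_top.congr' ?_ EventuallyEq.rfl
  filter_upwards [eventually_gt_atTop 1] with t ht
  unfold mm
  rw [indicator_of_notMem]
  · simp
  · simp; intro; linarith

lemma mm_bot : mm =O[𝓝[>] 0] (fun t : ℝ => t ^ (-0 : ℝ)) := by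
  refine Asymptotics.IsBigO.of_bound (1/2) ?_
  filter_upwards [Ioc_mem_nhdsGT (zero_lt_one' ℝ)] with t ht
  unfold mm
  rw [indicator_of_mem ht]
  have := kk_abs_half ht.1
  have h : (ee t : ℂ) - (t:ℂ)^(-1:ℂ) = ((kk t : ℝ) : ℂ) := by
    rw [cpow_neg_one]; unfold kk; push_cast; rfl
  rw [h, norm_real, Real.norm_eq_abs]
  simpa using this

lemma mm_mellin_diff {s : ℂ} (hs : 0 < s.re) : DifferentiableAt ℂ (mellin mm) s :=
  mellin_differentiableAt_of_isBigO_rpow_exp one_pos mm_locInt mm_top mm_bot hs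

lemma mm_mellinConv {s : ℂ} (hs : 0 < s.re) : MellinConvergent mm s :=
  mellinConvergent_of_isBigO_rpow_exp one_pos mm_locInt mm_top mm_bot hs

lemma mm_mellin_big {s : ℂ} (hs : 1 < s.re) :
    mellin mm s = Complex.Gamma s * riemannZeta s - 1 / (s - 1) := by
  have h1 := hasMellin_cpow_Ioc (-1) (s := s) (by simp; linarith)
  have h2 := (hasMellin_sub (ee_mellinConv hs) h1.1).2
  rw [h1.2, ee_mellin hs] at h2
  have h3 : mellin mm s = _ := h2
  rw [h3, sub_eq_add_neg s 1]

lemma mm_mellin {s : ℂ} (hs : 0 < s.re) (hs1 : s ≠ 1) :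
    mellin mm s = Complex.Gamma s * riemannZeta s - 1 / (s - 1) := by
  have ho : IsOpen {z : ℂ | 0 < z.re} := isOpen_lt continuous_const continuous_re
  have hA : AnalyticOnNhd ℂ (fun z => (z - 1) * mellin mm z) {z : ℂ | 0 < z.re} := by
    apply DifferentiableOn.analyticOnNhd _ ho
    intro z hz
    exact ((differentiableAt_id.sub_const 1).mul (mm_mellin_diff hz)).differentiableWithinAt
  have hB : AnalyticOnNhd ℂ (fun z => Complex.Gamma z * riemannZeta₁ z - 1) {z : ℂ | 0 < z.re} := by
    apply DifferentiableOn.analyticOnNhd _ ho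
    intro z hz
    refine (((Complex.differentiableAt_Gamma z ?_).mul
      differentiable_riemannZeta₁.differentiableAt).sub_const 1).differentiableWithinAt
    intro m hm
    have hz : 0 < z.re := hz
    rw [hm] at hz
    simp at hz
    have : (0:ℝ) ≤ m := by positivity
    linarith
  have hz1 : ∀ z : ℂ, z ≠ 1 → riemannZeta₁ z = (z - 1) * riemannZeta z := by
    intro z hz
    rw [riemannZeta_eq_inv_sub_mul hz, ← mul_assoc, mul_inv_cancel₀ (sub_ne_zero.mpr hz), one_mul]
  have hE := hA.eqOn_of_preconnected_of_eventuallyEq hB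
    (convex_halfSpace_re_gt 0).isPreconnected (z₀ := 2) (by simp) ?_ hs
  · simp only [hz1 s hs1] at hE
    have := sub_ne_zero.mpr hs1
    field_simp
    linear_combination hE
  · have : {z : ℂ | 1 < z.re} ∈ 𝓝 (2:ℂ) :=
      (isOpen_lt continuous_const continuous_re).mem_nhds (by simp)
    filter_upwards [this] with z hz
    have hz1' : z ≠ 1 := by rintro rfl; simp at hz
    rw [mm_mellin_big hz, hz1 z hz1']
    have := sub_ne_zero.mpr hz1'
    field_simp

lemma kk_mellinConv {s : ℂ} (hs : 0 < s.re) (hs1 : s.re < 1) :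
    MellinConvergent (fun t => (kk t : ℂ)) s := by
  refine mellinConvergent_of_isBigO_rpow (a := 1) (b := 0) (locInt_ofReal kk_contOn) ?_ hs1 ?_ hs
  · refine Asymptotics.IsBigO.of_bound 1 ?_
    filter_upwards [eventually_gt_atTop 0] with t ht
    rw [norm_real, Real.norm_eq_abs, Real.rpow_neg_one, Real.norm_of_nonneg (inv_pos.mpr ht).le]
    simpa using kk_abs_inv ht
  · refine Asymptotics.IsBigO.of_bound (1/2) ?_
    filter_upwards [self_mem_nhdsWithin] with t ht
    rw [norm_real, Real.norm_eq_abs]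
    simpa using kk_abs_half ht

lemma kk_mellin {s : ℂ} (hs : 0 < s.re) (hs1 : s.re < 1) :
    mellin (fun t => (kk t : ℂ)) s = Complex.Gamma s * riemannZeta s := by
  have hne : s ≠ 1 := by rintro rfl; simp at hs1
  have h1 := mm_mellin hs hne
  have h2 := integral_Ioi_cpow_of_lt (a := s - 2) (c := 1) (by simp; linarith) one_pos
  have h3 := (hasMellin_sub (mm_mellinConv hs) (kk_mellinConv hs hs1)).2
  have h4 : mellin (fun t => mm t - (kk t : ℂ)) s = ∫ t : ℝ in Ioi 1, (t:ℂ) ^ (s - 2) := by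
    unfold mellin
    have : ∫ t : ℝ in Ioi 1, (t:ℂ) ^ (s - 2) = ∫ t : ℝ in Ioi 0, indicator (Ioi 1) (fun t : ℝ => (t:ℂ) ^ (s - 2)) t := by
      rw [setIntegral_indicator measurableSet_Ioi]
      congr 2
      ext x; simp
    rw [this]
    apply setIntegral_congr_fun measurableSet_Ioi
    intro t ht
    have ht : 0 < t := ht
    have ht' : (t:ℂ) ≠ 0 := by exact_mod_cast ht.ne'
    by_cases h : t ≤ 1
    · have m1 : t ∈ Ioc (0:ℝ) 1 := ⟨ht, h⟩
      have m2 : t ∉ Ioi (1:ℝ) := by simpa using h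
      simp only [mm, kk, indicator_of_mem m1, indicator_of_notMem m2, cpow_neg_one]
      push_cast; simp
    · have m1 : t ∉ Ioc (0:ℝ) 1 := fun h' => h h'.2
      have m2 : t ∈ Ioi (1:ℝ) := by simpa using h
      simp only [mm, kk, indicator_of_mem m2, indicator_of_notMem m1]
      rw [show s - 2 = (s - 1) + (-1) by ring, cpow_add _ _ ht', cpow_neg_one]
      push_cast; simp
  rw [h4, h2, h1] at h3
  have h5 := sub_ne_zero.mpr hne
  have : s - 2 + 1 = s - 1 := by ring
  rw [this] at h3
  simp only [ofReal_one, one_cpow] at h3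
  linear_combination h3

def KK (x : ℝ) : ℝ := ∫ t in Ioi (0:ℝ), kk t * kk (x * t)

lemma kk_prod_bound {c y t : ℝ} (hc : 0 < c) (hc1 : c ≤ 1) (hy : c ≤ y) (ht : 0 < t) :
    ‖kk t * kk (y * t)‖ ≤ 4 / c * (1 + t^2)⁻¹ := by
  have hy0 : 0 < y := by linarith
  rw [norm_mul, Real.norm_eq_abs, Real.norm_eq_abs]
  calc |kk t| * |kk (y*t)| ≤ (2 / (1 + t)) * (2 / (1 + y * t)) := by
        apply mul_le_mul (kk_abs ht) (kk_abs (by positivity)) (abs_nonneg _) (by positivity)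
    _ = 4 / ((1 + t) * (1 + y * t)) := by field_simp; norm_num
    _ ≤ 4 / (c * (1 + t^2)) := by
        apply div_le_div_of_nonneg_left (by norm_num) (by positivity)
        have h1 : c * t ≤ y * t := by gcongr
        have h2 : c * (1 + t) ≤ 1 + y * t := by linarith
        have h3 : (1 + t) * (c * (1 + t)) ≤ (1 + t) * (1 + y * t) := by gcongr
        nlinarith [mul_pos hc ht]
    _ = 4 / c * (1 + t^2)⁻¹ := by field_simp

lemma KK_integrable {y : ℝ} (hy : 0 < y) : IntegrableOn (fun t => kk t * kk (y * t)) (Ioi 0) := by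
  have hb : IntegrableOn (fun t : ℝ => 4 / (min 1 y) * (1 + t^2)⁻¹) (Ioi 0) :=
    (integrable_inv_one_add_sq.const_mul _).integrableOn
  refine Integrable.mono' hb ?_ ?_
  · exact (kk_meas.mul (kk_meas.comp (measurable_const_mul y))).aestronglyMeasurable
  · refine (ae_restrict_iff' measurableSet_Ioi).mpr (Eventually.of_forall fun t ht => ?_)
    exact kk_prod_bound (by positivity) (min_le_left _ _) (min_le_right _ _) ht

lemma KK_cont {x : ℝ} (hx : 0 < x) : ContinuousAt KK x := by
  unfold KK
  refine continuousAt_of_dominated (bound := fun t : ℝ => 4 / (min 1 (x/2)) * (1 + t^2)⁻¹) ?_ ?_ ?_ ?_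
  · refine Eventually.of_forall fun y => ?_
    exact (kk_meas.mul (kk_meas.comp (measurable_const_mul y))).aestronglyMeasurable
  · filter_upwards [lt_mem_nhds (by linarith : x/2 < x)] with y hy
    refine (ae_restrict_iff' measurableSet_Ioi).mpr (Eventually.of_forall fun t ht => ?_)
    exact kk_prod_bound (by positivity) (min_le_left _ _) ((min_le_right _ _).trans hy.le) ht
  · exact (integrable_inv_one_add_sq.const_mul _).integrableOn
  · refine (ae_restrict_iff' measurableSet_Ioi).mpr (Eventually.of_forall fun t ht => ?_)
    have ht : 0 < t := ht
    have : ContinuousAt kk (x * t) := kk_contOn.continuousAt (Ioi_mem_nhds (by positivity))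
    exact continuousAt_const.mul (ContinuousAt.comp (f := fun y => y * t) this (by fun_prop))

def ff (s : ℂ) (p : ℝ × ℝ) : ℂ := (p.1 : ℂ) ^ (s - 1) * ((kk p.2 : ℂ) * (kk (p.1 * p.2) : ℂ))

lemma ff_meas (s : ℂ) : Measurable (ff s) := by
  unfold ff
  have h1 : Measurable fun p : ℝ × ℝ => (p.1 : ℂ) ^ (s - 1) :=
    (measurable_ofReal.comp measurable_fst).pow_const _
  have h2 : Measurable fun p : ℝ × ℝ => (kk p.2 : ℂ) :=
    measurable_ofReal.comp (kk_meas.comp measurable_snd)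
  have h3 : Measurable fun p : ℝ × ℝ => (kk (p.1 * p.2) : ℂ) :=
    measurable_ofReal.comp (kk_meas.comp (measurable_fst.mul measurable_snd))
  exact h1.mul (h2.mul h3)

lemma ff_inner_int {s : ℂ} (hs : 0 < s.re) (hs1 : s.re < 1) {t : ℝ} (ht : 0 < t) :
    IntegrableOn (fun x => ff s (x, t)) (Ioi 0) := by
  have h := (MellinConvergent.comp_mul_left (f := fun t => (kk t : ℂ)) (s := s) ht).mpr (kk_mellinConv hs hs1)
  have h2 := Integrable.const_mul h (kk t : ℂ)
  refine h2.congr (Eventually.of_forall fun x => ?_)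
  simp only [ff, smul_eq_mul, mul_comm t x]
  ring

lemma ff_inner {s : ℂ} {t : ℝ} (ht : 0 < t) :
    ∫ x in Ioi (0:ℝ), ff s (x, t) = (kk t : ℂ) * ((t:ℂ) ^ (-s) * mellin (fun t => (kk t : ℂ)) s) := by
  have h := mellin_comp_mul_left (fun t => (kk t : ℂ)) s ht
  rw [smul_eq_mul] at h
  rw [← h, mellin, ← integral_const_mul]
  congr 1
  ext x
  simp only [ff, smul_eq_mul, mul_comm t x]
  ring

lemma ff_outer_int {s : ℂ} (hs : 0 < s.re) (hs1 : s.re < 1) (c : ℂ):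
    IntegrableOn (fun t : ℝ => (kk t : ℂ) * ((t:ℂ) ^ (-s) * c)) (Ioi 0) := by
  have h := kk_mellinConv (s := 1 - s) (by simp; linarith) (by simp; linarith)
  have h2 := Integrable.mul_const h c
  refine h2.congr (Eventually.of_forall fun x => ?_)
  simp only [smul_eq_mul]
  rw [show 1 - s - 1 = -s by ring]
  ring

lemma ff_norm {s : ℂ} {x t : ℝ} (hx : 0 < x) (ht : 0 < t) :
    ((‖ff s (x, t)‖ : ℝ) : ℂ) = ff (s.re : ℂ) (x, t) := by
  unfold ff
  simp only [norm_mul, norm_cpow_eq_rpow_re_of_pos hx, norm_real, Real.norm_eq_abs]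
  rw [abs_of_nonpos (kk_nonpos ht), abs_of_nonpos (kk_nonpos (mul_pos hx ht))]
  push_cast
  rw [ofReal_cpow hx.le]
  simp

lemma ff_int {s : ℂ} (hs : 0 < s.re) (hs1 : s.re < 1) :
    Integrable (ff s) ((volume.restrict (Ioi (0:ℝ))).prod (volume.restrict (Ioi (0:ℝ)))) := by
  rw [integrable_prod_iff' (ff_meas s).aestronglyMeasurable]
  constructor
  · refine (ae_restrict_iff' measurableSet_Ioi).mpr (Eventually.of_forall fun t ht => ?_)
    exact ff_inner_int hs hs1 ht
  · have h := (ff_outer_int (s := (s.re : ℂ)) (by simpa using hs) (by simpa using hs1)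
      (mellin (fun t => (kk t : ℂ)) (s.re : ℂ))).re
    refine h.congr ?_
    refine (ae_restrict_iff' measurableSet_Ioi).mpr (Eventually.of_forall fun t ht => ?_)
    have ht : 0 < t := ht
    simp only
    rw [← ff_inner ht]
    have : ∫ x in Ioi (0:ℝ), ff (s.re : ℂ) (x, t) = ((∫ x in Ioi (0:ℝ), ‖ff s (x,t)‖ : ℝ) : ℂ) := by
      rw [← integral_complex_ofReal]
      apply setIntegral_congr_fun measurableSet_Ioi
      intro x hx
      exact (ff_norm hx ht).symm
    rw [this]
    simp

lemma KK_fun (s : ℂ) (x : ℝ) : (x:ℂ) ^ (s - 1) • (KK x : ℂ) = ∫ t in Ioi (0:ℝ), ff s (x, t) := by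
  unfold KK ff
  rw [← integral_complex_ofReal, smul_eq_mul, ← integral_const_mul]
  push_cast
  rfl

lemma KK_mellinConv {s : ℂ} (hs : 0 < s.re) (hs1 : s.re < 1) :
    MellinConvergent (fun t => (KK t : ℂ)) s := by
  have := (ff_int hs hs1).integral_prod_left
  refine this.congr (Eventually.of_forall fun x => ?_)
  exact (KK_fun s x).symm

lemma KK_mellin {s : ℂ} (hs : 0 < s.re) (hs1 : s.re < 1) :
    mellin (fun t => (KK t : ℂ)) s =
      mellin (fun t => (kk t : ℂ)) s * mellin (fun t => (kk t : ℂ)) (1 - s) := by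
  rw [mellin]
  simp_rw [KK_fun]
  rw [integral_integral_swap (f := fun x t => ff s (x, t)) (ff_int hs hs1)]
  rw [mellin.eq_1 _ (1 - s), ← integral_const_mul]
  apply setIntegral_congr_fun measurableSet_Ioi
  intro t ht
  simp only
  rw [ff_inner ht, smul_eq_mul, show 1 - s - 1 = -s by ring]
  ring

lemma kd_contOn : ContinuousOn kd (Ioi 0) := by
  unfold kd
  refine ContinuousOn.add ?_ ?_
  · have := ee_contOn
    fun_prop
  · apply ContinuousOn.inv₀ (by fun_prop)
    intro x hx
    have : (0:ℝ) < x := hx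
    positivity

lemma kd_mellinConv {s : ℂ} (hs : s.re = 1/2) : MellinConvergent (fun t => (kd t : ℂ)) (s + 1) := by
  refine mellinConvergent_of_isBigO_rpow (a := 2) (b := 1) (locInt_ofReal kd_contOn) ?_ (by simp [hs]; norm_num) ?_ (by simp [hs])
  · refine Asymptotics.IsBigO.of_bound 1 ?_
    filter_upwards [eventually_gt_atTop 0] with t ht
    rw [norm_real, Real.norm_of_nonneg (kd_nonneg ht), Real.norm_of_nonneg (by positivity), Real.rpow_neg ht.le]
    simpa using kd_le_inv_sq ht
  · refine Asymptotics.IsBigO.of_bound 1 ?_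
    filter_upwards [self_mem_nhdsWithin] with t ht
    have ht : 0 < t := ht
    rw [norm_real, Real.norm_of_nonneg (kd_nonneg ht), Real.norm_of_nonneg (by positivity), Real.rpow_neg_one]
    simpa using kd_le_inv ht

lemma kk_bound : ∃ C : ℝ, 0 ≤ C ∧ ∀ s : ℂ, s.re = 1/2 → ‖mellin (fun t => (kk t : ℂ)) s‖ ≤ C / ‖s‖ := by
  refine ⟨∫ t in Ioi (0:ℝ), t ^ (1/2 : ℝ) * kd t, ?_, ?_⟩
  · apply setIntegral_nonneg measurableSet_Ioi
    intro t ht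
    have ht : 0 < t := ht
    exact mul_nonneg (by positivity) (kd_nonneg ht)
  · intro s hs
    have hs0 : s ≠ 0 := by rintro rfl; simp at hs
    have hn : 0 < ‖s‖ := norm_pos_iff.mpr hs0
    have hnorm : ∀ t : ℝ, 0 < t → ‖(t:ℂ) ^ s‖ = t ^ (1/2:ℝ) := by
      intro t ht; rw [norm_cpow_eq_rpow_re_of_pos ht, hs]
    have key := integral_Ioi_mul_deriv_eq_deriv_mul (a := (0:ℝ)) (a' := (0:ℂ)) (b' := 0)
      (u := fun t => (kk t : ℂ)) (u' := fun t => (kd t : ℂ)) (v := fun t : ℝ => (t:ℂ) ^ s / s)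
      (v' := fun t : ℝ => (t:ℂ) ^ (s - 1)) ?_ ?_ ?_ ?_ ?_ ?_
    · have h1 : mellin (fun t => (kk t : ℂ)) s = ∫ (x : ℝ) in Ioi 0, (kk x : ℂ) * (x:ℂ) ^ (s - 1) := by
        rw [mellin]; congr 1; ext x; rw [smul_eq_mul, mul_comm]
      rw [h1, key]
      simp only [sub_zero, zero_sub, norm_neg]
      refine (norm_integral_le_integral_norm _).trans (le_of_eq ?_)
      rw [← integral_div]
      apply setIntegral_congr_fun measurableSet_Ioi
      intro t ht
      have ht : 0 < t := ht
      simp only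
      rw [norm_mul, norm_div, hnorm t ht, norm_real, Real.norm_of_nonneg (kd_nonneg ht)]
      ring
    · intro t ht; exact (kk_hasDeriv ht).ofReal_comp
    · intro t ht
      have ht : 0 < t := ht
      have := (hasDerivAt_ofReal_cpow_const ht.ne' hs0).div_const s
      rwa [mul_div_cancel_left₀ _ hs0] at this
    · refine IntegrableOn.congr_fun (kk_mellinConv (s := s) (by rw [hs]; norm_num) (by rw [hs]; norm_num)) ?_ measurableSet_Ioi
      intro t ht
      simp [mul_comm]
    · refine IntegrableOn.congr_fun (Integrable.div_const (kd_mellinConv hs) s) ?_ measurableSet_Ioi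
      intro t ht
      simp
      ring
    · rw [tendsto_zero_iff_norm_tendsto_zero]
      have hl : Tendsto (fun t : ℝ => (1/2) * (t ^ (1/2:ℝ) / ‖s‖)) (𝓝[>] 0) (𝓝 0) := by
        have : Tendsto (fun t : ℝ => (1/2) * (t ^ (1/2:ℝ) / ‖s‖)) (𝓝 0) (𝓝 ((1/2) * ((0:ℝ) ^ (1/2:ℝ) / ‖s‖))) := by
          refine Tendsto.const_mul _ (Tendsto.div_const ?_ _)
          exact (Real.continuousAt_rpow_const 0 (1/2) (Or.inr (by norm_num))).tendsto
        rw [Real.zero_rpow (by norm_num)] at this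
        simp only [zero_div, mul_zero] at this
        exact this.mono_left nhdsWithin_le_nhds
      refine squeeze_zero' (Eventually.of_forall fun t => norm_nonneg _) ?_ hl
      filter_upwards [self_mem_nhdsWithin] with t ht
      have ht : 0 < t := ht
      simp only [Pi.mul_apply]
      rw [norm_mul, norm_div, hnorm t ht, norm_real, Real.norm_eq_abs]
      gcongr
      exact kk_abs_half ht
    · rw [tendsto_zero_iff_norm_tendsto_zero]
      have hl : Tendsto (fun t : ℝ => t ^ (-(1/2):ℝ) / ‖s‖) atTop (𝓝 0) := by
        simpa using (tendsto_rpow_neg_atTop (by norm_num : (0:ℝ) < 1/2)).div_const ‖s‖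
      refine squeeze_zero' (Eventually.of_forall fun t => norm_nonneg _) ?_ hl
      filter_upwards [eventually_gt_atTop 0] with t ht
      simp only [Pi.mul_apply]
      rw [norm_mul, norm_div, hnorm t ht, norm_real, Real.norm_eq_abs]
      have h := kk_abs_inv ht
      calc |kk t| * (t ^ (1/2:ℝ) / ‖s‖) ≤ t⁻¹ * (t ^ (1/2:ℝ) / ‖s‖) := by gcongr
        _ = t ^ (-(1/2):ℝ) / ‖s‖ := by
          rw [← mul_div_assoc, ← Real.rpow_neg_one, ← Real.rpow_add ht]; norm_num

def WW (y : ℝ) : ℂ := (Complex.Gamma (1/2 + y * I) * riemannZeta (1/2 + y * I)) *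
  (Complex.Gamma (1/2 - y * I) * riemannZeta (1/2 - y * I))

lemma KK_mellin_half (y : ℝ) : mellin (fun t => (KK t : ℂ)) (1/2 + y * I) = WW y := by
  have h1 : (1/2 + y * I : ℂ).re = 1/2 := by simp
  have h2 : (1/2 - y * I : ℂ).re = 1/2 := by simp
  rw [KK_mellin (by rw [h1]; norm_num) (by rw [h1]; norm_num),
    show (1:ℂ) - (1/2 + y * I) = 1/2 - y * I by ring,
    kk_mellin (by rw [h1]; norm_num) (by rw [h1]; norm_num),
    kk_mellin (by rw [h2]; norm_num) (by rw [h2]; norm_num), WW]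

lemma gz_diff {s : ℂ} (h : s.re = 1/2) : DifferentiableAt ℂ (fun s => Complex.Gamma s * riemannZeta s) s := by
  refine (Complex.differentiableAt_Gamma s ?_).mul (differentiableAt_riemannZeta ?_)
  · intro m hm
    rw [hm] at h
    simp at h
    have : (0:ℝ) ≤ m := by positivity
    linarith
  · rintro rfl; norm_num at h

lemma WW_cont : Continuous WW := by
  rw [continuous_iff_continuousAt]
  intro y
  have h1 : (1/2 + y * I : ℂ).re = 1/2 := by simp
  have h2 : (1/2 - y * I : ℂ).re = 1/2 := by simp
  unfold WW
  refine ContinuousAt.mul ?_ ?_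
  · exact ContinuousAt.comp (f := fun y : ℝ => (1/2 + y * I : ℂ)) (g := fun s => Complex.Gamma s * riemannZeta s)
      (gz_diff h1).continuousAt (by fun_prop)
  · exact ContinuousAt.comp (f := fun y : ℝ => (1/2 - y * I : ℂ)) (g := fun s => Complex.Gamma s * riemannZeta s)
      (gz_diff h2).continuousAt (by fun_prop)

lemma norm_half (y : ℝ) : ‖(1/2 + y * I : ℂ)‖ ^ 2 = 1/4 + y^2 := by
  rw [← normSq_eq_norm_sq, normSq_apply]; simp; ring

lemma WW_int : Integrable WW := by
  obtain ⟨C, hC, hb⟩ := kk_bound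
  refine Integrable.mono' (integrable_inv_one_add_sq.const_mul (4 * C^2)) WW_cont.aestronglyMeasurable ?_
  refine Eventually.of_forall fun y => ?_
  have h1 : (1/2 + y * I : ℂ).re = 1/2 := by simp
  have h2 : (1/2 - y * I : ℂ).re = 1/2 := by simp
  have b1 := hb _ h1
  have b2 := hb _ h2
  rw [kk_mellin (by rw [h1]; norm_num) (by rw [h1]; norm_num)] at b1
  rw [kk_mellin (by rw [h2]; norm_num) (by rw [h2]; norm_num)] at b2
  have e2 : ‖(1/2 - y * I : ℂ)‖ = ‖(1/2 + y * I : ℂ)‖ := by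
    rw [← Complex.norm_conj]; congr 1; simp [sub_eq_add_neg, Complex.conj_ofNat]
  rw [e2] at b2
  have hsq := norm_half y
  set n := ‖(1/2 + y * I : ℂ)‖
  unfold WW
  rw [norm_mul]
  calc _ ≤ (C / n) * (C / n) := mul_le_mul b1 b2 (norm_nonneg _) (by positivity)
    _ = C^2 / (n^2) := by ring
    _ = C^2 / (1/4 + y^2) := by rw [hsq]
    _ ≤ C^2 / ((1 + y^2)/4) := by
        apply div_le_div_of_nonneg_left (by positivity) (by positivity)
        nlinarith [sq_nonneg y]
    _ = _ := by field_simp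

lemma KK_inv {x : ℝ} (hx : 0 < x) :
    (KK x : ℂ) = (1 / (2 * Real.pi) : ℝ) * ∫ y : ℝ, (x:ℂ) ^ (-(1/2 + y * I)) * WW y := by
  have h := mellinInv_mellin_eq (1/2) (fun t => (KK t : ℂ)) hx ?_ ?_ ?_
  · rw [← h, mellinInv]
    rw [Complex.real_smul]
    congr 2
    ext y
    have : (((1/2:ℝ):ℂ) + y * I) = 1/2 + y * I := by push_cast; ring
    rw [this, KK_mellin_half, smul_eq_mul]
  · exact KK_mellinConv (by simp) (by simp; norm_num)
  · unfold VerticalIntegrable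
    refine WW_int.congr (Eventually.of_forall fun y => ?_)
    have : (((1/2:ℝ):ℂ) + y * I) = 1/2 + y * I := by push_cast; ring
    simp only [this, KK_mellin_half]
  · exact continuous_ofReal.continuousAt.comp (KK_cont hx)

lemma logGamma_hasDeriv {x : ℝ} (hx : 0 < x) : HasDerivAt (Real.log ∘ Real.Gamma) (digam x) x := by
  have hd : DifferentiableAt ℝ Real.Gamma x := Real.differentiableAt_Gamma (fun m => by
    have : (0:ℝ) ≤ m := by positivity
    linarith)
  exact hd.hasDerivAt.log (Real.Gamma_pos_of_pos hx).ne'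

lemma logGamma_add_one {x : ℝ} (hx : 0 < x) :
    Real.log (Real.Gamma (x + 1)) = Real.log (Real.Gamma x) + Real.log x := by
  rw [Real.Gamma_add_one hx.ne', Real.log_mul hx.ne' (Real.Gamma_pos_of_pos hx).ne', add_comm]

lemma digam_add_one {x : ℝ} (hx : 0 < x) : digam (x + 1) = digam x + 1 / x := by
  have h1 : HasDerivAt (fun y => (Real.log ∘ Real.Gamma) (y + 1)) (digam (x+1)) x :=
    (logGamma_hasDeriv (by linarith : 0 < x + 1)).comp_add_const x 1
  have h2 : HasDerivAt (fun y => (Real.log ∘ Real.Gamma) y + Real.log y) (digam x + x⁻¹) x :=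
    (logGamma_hasDeriv hx).add (Real.hasDerivAt_log hx.ne')
  rw [one_div]
  refine h1.unique (h2.congr_of_eventuallyEq ?_)
  filter_upwards [lt_mem_nhds hx] with y hy
  exact logGamma_add_one hy

lemma digam_le {x : ℝ} (hx : 0 < x) : digam x ≤ Real.log x := by
  have := Real.convexOn_log_Gamma.le_slope_of_hasDerivAt (mem_Ioi.mpr hx)
    (mem_Ioi.mpr (by linarith : 0 < x + 1)) (by linarith) (logGamma_hasDeriv hx)
  rw [slope_def_field] at this
  simp only [Function.comp, logGamma_add_one hx] at this
  simpa using this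

lemma digam_ge {x : ℝ} (hx : 0 < x) : Real.log x - 1 / x ≤ digam x := by
  have := Real.convexOn_log_Gamma.slope_le_of_hasDerivAt (mem_Ioi.mpr hx)
    (mem_Ioi.mpr (by linarith : 0 < x + 1)) (by linarith) (logGamma_hasDeriv (by linarith : 0 < x + 1))
  rw [slope_def_field, digam_add_one hx] at this
  simp only [Function.comp, logGamma_add_one hx] at this
  simp at this
  rw [one_div]
  linarith

lemma phi_abs {x : ℝ} (hx : 0 < x) : |phi x| ≤ 1 / (2 * x) := by
  have h1 := digam_le hx
  have h2 := digam_ge hx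
  have h3 : 1 / x = 1 / (2 * x) + 1 / (2 * x) := by field_simp; norm_num
  unfold phi
  rw [abs_le]
  constructor <;> linarith

lemma phi_add_one {x : ℝ} (hx : 0 < x) :
    phi (x + 1) - phi x = 1 / (2 * x) + 1 / (2 * (x + 1)) - (Real.log (x + 1) - Real.log x) := by
  unfold phi
  rw [digam_add_one hx]
  have h3 : 1 / x = 1 / (2 * x) + 1 / (2 * x) := by field_simp; norm_num
  rw [h3]
  ring

def hh (t : ℝ) : ℝ := kk t + 1/2
lemma hh_meas : Measurable hh := kk_meas.add_const _
lemma hh_nonneg {t : ℝ} (ht : 0 < t) : 0 ≤ hh t := by have := kk_ge ht; unfold hh; linarith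
lemma hh_le {t : ℝ} (ht : 0 < t) : hh t ≤ 1/2 := by have := kk_nonpos ht; unfold hh; linarith
lemma hh_le' {t : ℝ} (ht : 0 < t) : hh t ≤ t/2 := by have := kk_le ht; unfold hh; linarith

def BB (x : ℝ) : ℝ := ∫ t in Ioi (0:ℝ), hh t * Real.exp (-x * t)

lemma exp_int {x : ℝ} (hx : 0 < x) : IntegrableOn (fun t => Real.exp (-x * t)) (Ioi 0) :=
  integrableOn_exp_mul_Ioi (by linarith) 0

lemma exp_integral {x : ℝ} (hx : 0 < x) : ∫ t in Ioi (0:ℝ), Real.exp (-x * t) = 1 / x := by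
  rw [integral_exp_mul_Ioi (by linarith) 0]
  simp

lemma BB_int {x : ℝ} (hx : 0 < x) : IntegrableOn (fun t => hh t * Real.exp (-x * t)) (Ioi 0) := by
  refine Integrable.mono' ((exp_int hx).const_mul (1/2)) ?_ ?_
  · exact (hh_meas.mul (by fun_prop)).aestronglyMeasurable
  · refine (ae_restrict_iff' measurableSet_Ioi).mpr (Eventually.of_forall fun t ht => ?_)
    rw [Real.norm_of_nonneg (mul_nonneg (hh_nonneg ht) (Real.exp_pos _).le)]
    gcongr
    exact hh_le ht

lemma BB_abs {x : ℝ} (hx : 0 < x) : |BB x| ≤ 1 / (2 * x) := by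
  have h0 : 0 ≤ BB x := setIntegral_nonneg measurableSet_Ioi
    (fun t ht => mul_nonneg (hh_nonneg ht) (Real.exp_pos _).le)
  rw [abs_of_nonneg h0]
  have : BB x ≤ ∫ t in Ioi (0:ℝ), (1/2) * Real.exp (-x * t) := by
    refine setIntegral_mono_on (BB_int hx) ((exp_int hx).const_mul (1/2)) measurableSet_Ioi ?_
    intro t ht
    gcongr
    exact hh_le ht
  rw [integral_const_mul, exp_integral hx] at this
  refine this.trans (le_of_eq ?_)
  field_simp

lemma frullani {x : ℝ} (hx : 0 < x) :
    IntegrableOn (fun t => (Real.exp (-x * t) - Real.exp (-(x+1) * t)) / t) (Ioi 0) ∧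
    ∫ t in Ioi (0:ℝ), (Real.exp (-x * t) - Real.exp (-(x+1) * t)) / t = Real.log (x + 1) - Real.log x := by
  have hI : Integrable (Function.uncurry fun (u t : ℝ) => Real.exp (-u * t))
      ((volume.restrict (Ioc x (x+1))).prod (volume.restrict (Ioi (0:ℝ)))) := by
    rw [integrable_prod_iff]
    · constructor
      · refine (ae_restrict_iff' measurableSet_Ioc).mpr (Eventually.of_forall fun u hu => ?_)
        exact exp_int (hx.trans hu.1)
      · have : IntegrableOn (fun u : ℝ => 1 / u) (Ioc x (x+1)) := by
          rw [← intervalIntegrable_iff_integrableOn_Ioc_of_le (by linarith)]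
          apply intervalIntegral.intervalIntegrable_one_div
          · intro u hu
            rw [uIcc_of_le (by linarith)] at hu
            linarith [hu.1]
          · fun_prop
        refine IntegrableOn.congr_fun this ?_ measurableSet_Ioc
        intro u hu
        simp only [Function.uncurry_apply_pair, Real.norm_eq_abs, Real.abs_exp]
        exact (exp_integral (hx.trans hu.1)).symm
    · apply Continuous.aestronglyMeasurable
      unfold Function.uncurry
      fun_prop
  have hin : ∀ t : ℝ, 0 < t → ∫ u in Ioc x (x+1), Real.exp (-u * t) =
      (Real.exp (-x * t) - Real.exp (-(x+1) * t)) / t := by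
    intro t ht
    rw [← intervalIntegral.integral_of_le (by linarith)]
    have := intervalIntegral.integral_eq_sub_of_hasDerivAt (a := x) (b := x + 1)
      (f := fun u => - Real.exp (-u * t) / t) (f' := fun u => Real.exp (-u * t)) ?_ ?_
    · rw [this]; ring
    · intro u _
      have h1 : HasDerivAt (fun u : ℝ => -u * t) (-1 * t) u := (hasDerivAt_id u).neg.mul_const t
      have := h1.exp.neg.div_const t
      refine this.congr_deriv ?_
      field_simp
    · apply Continuous.intervalIntegrable; fun_prop
  constructor
  · refine IntegrableOn.congr_fun hI.integral_prod_right ?_ measurableSet_Ioi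
    intro t ht
    exact hin t ht
  · rw [← setIntegral_congr_fun measurableSet_Ioi (fun t ht => hin t ht)]
    rw [← integral_integral_swap hI]
    have : ∫ u in Ioc x (x+1), ∫ t in Ioi (0:ℝ), Real.exp (-u * t) = ∫ u in Ioc x (x+1), 1 / u := by
      apply setIntegral_congr_fun measurableSet_Ioc
      intro u hu
      exact exp_integral (hx.trans hu.1)
    rw [this, ← intervalIntegral.integral_of_le (by linarith),
      integral_one_div_of_pos hx (by linarith), Real.log_div (by linarith) hx.ne']

lemma BB_sub {x : ℝ} (hx : 0 < x) :
    BB x - BB (x + 1) = 1 / (2 * x) + 1 / (2 * (x + 1)) - (Real.log (x + 1) - Real.log x) := by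
  have hx1 : 0 < x + 1 := by linarith
  unfold BB
  rw [← integral_sub (BB_int hx) (BB_int hx1)]
  obtain ⟨f1, f2⟩ := frullani hx
  have e1 := exp_int hx
  have e2 := exp_int hx1
  have : ∫ t in Ioi (0:ℝ), (hh t * Real.exp (-x * t) - hh t * Real.exp (-(x+1) * t)) =
      ∫ t in Ioi (0:ℝ), ((1/2 * Real.exp (-x * t) + 1/2 * Real.exp (-(x+1) * t)) -
        (Real.exp (-x * t) - Real.exp (-(x+1) * t)) / t) := by
    apply setIntegral_congr_fun measurableSet_Ioi
    intro t ht
    have ht : 0 < t := ht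
    have hs : Real.exp (-x * t) = Real.exp t * Real.exp (-(x+1) * t) := by
      rw [← Real.exp_add]; ring_nf
    have := expm1_pos ht
    simp only [hh, kk, ee, hs]
    field_simp
    ring
  have i1 : IntegrableOn (fun t => 1/2 * Real.exp (-x * t)) (Ioi 0) := e1.const_mul _
  have i2 : IntegrableOn (fun t => 1/2 * Real.exp (-(x+1) * t)) (Ioi 0) := e2.const_mul _
  have i3 : IntegrableOn (fun t => 1/2 * Real.exp (-x * t) + 1/2 * Real.exp (-(x+1) * t)) (Ioi 0) := i1.add i2
  rw [this, integral_sub i3 f1, integral_add i1 i2, f2, integral_const_mul, integral_const_mul,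
    exp_integral hx, exp_integral hx1]
  field_simp

lemma phi_eq {x : ℝ} (hx : 0 < x) : phi x = - BB x := by
  have hstep : ∀ y : ℝ, 0 < y → phi (y + 1) + BB (y + 1) = phi y + BB y := by
    intro y hy
    have := phi_add_one hy
    have := BB_sub hy
    linarith
  have hn : ∀ n : ℕ, phi (x + n) + BB (x + n) = phi x + BB x := by
    intro n
    induction n with
    | zero => simp
    | succ n ih =>
      rw [← ih, ← hstep (x + n) (by positivity)]
      push_cast
      rw [add_assoc]
  have hlim : Tendsto (fun n : ℕ => phi (x + n) + BB (x + n)) atTop (𝓝 0) := by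
    apply squeeze_zero_norm' (a := fun n : ℕ => 1 / (x + n)) 
    · refine Eventually.of_forall fun n => ?_
      have hp : 0 < x + n := by positivity
      have h3 : 1 / (x + n) = 1 / (2 * (x+n)) + 1 / (2 * (x+n)) := by field_simp; norm_num
      rw [h3]
      exact (norm_add_le _ _).trans (add_le_add (phi_abs hp) (BB_abs hp))
    · simp only [one_div]
      exact (tendsto_atTop_add_const_left _ x tendsto_natCast_atTop_atTop).inv_tendsto_atTop
  simp only [hn] at hlim
  have := tendsto_nhds_unique hlim tendsto_const_nhds
  linarith

lemma sum_phi {α : ℝ} (hα : 0 < α) :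
    ∑' n : ℕ+, phi (n * α) = - ∫ t in Ioi (0:ℝ), hh t * ee (α * t) := by
  have h1 := tsum_pnat_eq_tsum_succ (f := fun n : ℕ => phi (n * α))
  rw [h1]
  have hp : ∀ n : ℕ, 0 < ((n + 1 : ℕ) : ℝ) * α := fun n => by positivity
  have h2 : ∀ n : ℕ, phi (((n + 1 : ℕ) : ℝ) * α) = - BB (((n + 1 : ℕ) : ℝ) * α) := fun n => phi_eq (hp n)
  simp_rw [h2]
  rw [tsum_neg]
  congr 1
  have h3 := hasSum_integral_of_summable_integral_norm (μ := volume.restrict (Ioi (0:ℝ)))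
    (F := fun (n : ℕ) t => hh t * Real.exp (-(((n + 1 : ℕ) : ℝ) * α) * t)) (fun n => BB_int (hp n)) ?_
  · unfold BB
    rw [h3.tsum_eq]
    apply setIntegral_congr_fun measurableSet_Ioi
    intro t ht
    have ht : 0 < t := ht
    simp only
    rw [tsum_mul_left, ← (ee_hasSum (mul_pos hα ht)).tsum_eq]
    congr 2
    ext n
    push_cast
    ring_nf
  · have hs : Summable fun n : ℕ => (1 / (2 * α^2)) * (1 / ((n + 1 : ℕ) : ℝ) ^ 2) :=
      ((summable_nat_add_iff 1).mpr (Real.summable_one_div_nat_pow.mpr one_lt_two)).mul_left _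
    refine Summable.of_nonneg_of_le (fun n => integral_nonneg fun t => norm_nonneg _) ?_ hs
    intro n
    have hG := Real.integral_rpow_mul_exp_neg_mul_Ioi (a := 2) (r := ((n + 1 : ℕ) : ℝ) * α) (by norm_num) (hp n)
    have hI : IntegrableOn (fun t : ℝ => 1/2 * (t ^ ((2:ℝ) - 1) * Real.exp (-(((n + 1 : ℕ) : ℝ) * α * t)))) (Ioi 0) := by
      apply Integrable.const_mul
      by_contra hcon
      rw [integral_undef hcon] at hG
      have := hp n
      have : 0 < (1 / (((n + 1 : ℕ) : ℝ) * α)) ^ (2:ℝ) * Real.Gamma 2 := by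
        have := Real.Gamma_pos_of_pos (by norm_num : (0:ℝ) < 2)
        positivity
      linarith
    have hle : ∫ t in Ioi (0:ℝ), ‖hh t * Real.exp (-(((n + 1 : ℕ) : ℝ) * α) * t)‖ ≤
        ∫ t in Ioi (0:ℝ), 1/2 * (t ^ ((2:ℝ) - 1) * Real.exp (-(((n + 1 : ℕ) : ℝ) * α * t))) := by
      refine setIntegral_mono_on (BB_int (hp n)).norm hI measurableSet_Ioi ?_
      intro t ht
      have ht : 0 < t := ht
      rw [Real.norm_of_nonneg (mul_nonneg (hh_nonneg ht) (Real.exp_pos _).le), neg_mul, ← mul_assoc]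
      gcongr
      have := hh_le' ht
      norm_num
      linarith
    rw [integral_const_mul, hG, Real.Gamma_two] at hle
    refine hle.trans (le_of_eq ?_)
    norm_num
    field_simp

def JJ (α t : ℝ) : ℝ := 1/2 * ee (α * t) + kk t / (α * t)

lemma JJ_eq {α t : ℝ} (hα : 0 < α) (ht : 0 < t) :
    hh t * ee (α * t) = kk t * kk (α * t) + JJ α t := by
  unfold JJ hh
  have : kk (α * t) = ee (α * t) - (α * t)⁻¹ := rfl
  rw [this]; ring

lemma JJ_contOn {α : ℝ} (hα : 0 < α) : ContinuousOn (JJ α) (Ioi 0) := by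
  unfold JJ
  have h1 : ContinuousOn (fun t => ee (α * t)) (Ioi 0) :=
    ee_contOn.comp (by fun_prop) (fun t ht => by
      have ht : 0 < t := ht
      exact mul_pos hα ht)
  refine (h1.const_smul (1/2 : ℝ)).add (kk_contOn.div (by fun_prop) ?_)
  intro t ht
  have ht : 0 < t := ht
  positivity

lemma ee_le_sq {u : ℝ} (hu : 0 < u) : ee u ≤ 2 / u^2 := by
  have h := Real.quadratic_le_exp_of_nonneg hu.le
  unfold ee
  rw [inv_eq_one_div, div_le_div_iff₀ (expm1_pos hu) (by positivity)]
  nlinarith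

lemma JJ_top {α : ℝ} (hα : 0 < α) :
    (fun t => (JJ α t : ℂ)) =O[atTop] (fun t : ℝ => t ^ (-2 : ℝ)) := by
  refine Asymptotics.IsBigO.of_bound (1/α^2 + 1/α) ?_
  filter_upwards [eventually_gt_atTop 0] with t ht
  have e : t ^ (-2:ℝ) = (t^2)⁻¹ := by
    rw [Real.rpow_neg ht.le]; norm_cast
  rw [norm_real, Real.norm_eq_abs, e, Real.norm_of_nonneg (by positivity)]
  unfold JJ
  have hu : 0 < α * t := by positivity
  have h1 := ee_le_sq hu
  have h2 := kk_abs_inv ht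
  have h3 := ee_pos hu
  calc |1/2 * ee (α * t) + kk t / (α * t)| ≤ |1/2 * ee (α * t)| + |kk t / (α * t)| := abs_add_le _ _
    _ = 1/2 * ee (α*t) + |kk t| / (α * t) := by
      rw [abs_of_pos (by positivity), abs_div, abs_of_pos hu]
    _ ≤ 1/2 * (2 / (α*t)^2) + t⁻¹ / (α * t) := by gcongr
    _ = _ := by field_simp

lemma JJ_bot {α : ℝ} (hα : 0 < α) :
    (fun t => (JJ α t : ℂ)) =O[𝓝[>] 0] (fun t : ℝ => t ^ (-0 : ℝ)) := by
  refine Asymptotics.IsBigO.of_bound (1/4 + 1/(2*α)) ?_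
  filter_upwards [self_mem_nhdsWithin] with t ht
  have ht : 0 < t := ht
  rw [norm_real, Real.norm_eq_abs]
  have hu : 0 < α * t := by positivity
  have e : JJ α t = 1/2 * kk (α*t) + hh t / (α*t) := by
    unfold JJ hh
    have : kk (α * t) = ee (α * t) - (α * t)⁻¹ := rfl
    rw [this]; ring
  have h1 := kk_abs_half hu
  have h2 := hh_le' ht
  have h3 := hh_nonneg ht
  rw [e]
  calc |1/2 * kk (α * t) + hh t / (α * t)| ≤ |1/2 * kk (α * t)| + |hh t / (α * t)| := abs_add_le _ _
    _ = 1/2 * |kk (α*t)| + hh t / (α * t) := by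
      rw [abs_mul, abs_of_nonneg (div_nonneg h3 hu.le)]; norm_num
    _ ≤ 1/2 * (1/2) + (t/2) / (α * t) := by gcongr
    _ = _ := by simp; field_simp; ring

lemma JJ_conv {α : ℝ} (hα : 0 < α) {s : ℂ} (h0 : 0 < s.re) (h2 : s.re < 2) :
    MellinConvergent (fun t => (JJ α t : ℂ)) s :=
  mellinConvergent_of_isBigO_rpow (locInt_ofReal (JJ_contOn hα)) (JJ_top hα) h2 (JJ_bot hα) h0

lemma JJ_diff {α : ℝ} (hα : 0 < α) {s : ℂ} (h0 : 0 < s.re) (h2 : s.re < 2) :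
    DifferentiableAt ℂ (mellin (fun t => (JJ α t : ℂ))) s :=
  mellin_differentiableAt_of_isBigO_rpow (locInt_ofReal (JJ_contOn hα)) (JJ_top hα) h2 (JJ_bot hα) h0

lemma JJ_int {α : ℝ} (hα : 0 < α) : IntegrableOn (JJ α) (Ioi 0) := by
  have h := JJ_conv hα (s := 1) (by simp) (by simp)
  unfold MellinConvergent at h
  simp only [sub_self, cpow_zero, one_smul] at h
  have h' := h.re
  simp only [RCLike.re_to_complex, ofReal_re] at h'
  exact h'

lemma JJ_mellin {α : ℝ} (hα : 0 < α) {s : ℂ} (h0 : 1 < s.re) (h2 : s.re < 2) :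
    mellin (fun t => (JJ α t : ℂ)) s = 1/2 * (α:ℂ)^(-s) * (Complex.Gamma s * riemannZeta s)
      + (1/(α:ℂ)) * (Complex.Gamma (s-1) * riemannZeta (s-1)) := by
  have r1 : 0 < (s + (-1)).re := by simp; linarith
  have r2 : (s + (-1)).re < 1 := by simp; linarith
  have c1 : MellinConvergent (fun t => (1/2:ℂ) • ((ee (α * t) : ℝ):ℂ)) s :=
    ((MellinConvergent.comp_mul_left (f := fun t => (ee t : ℂ)) hα).mpr (ee_mellinConv h0)).const_smul _
  have c2 : MellinConvergent (fun t : ℝ => (1/(α:ℂ)) • ((t:ℂ)^(-1:ℂ) • (kk t : ℂ))) s :=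
    (MellinConvergent.cpow_smul.mpr (kk_mellinConv r1 r2)).const_smul _
  have h := (hasMellin_add c1 c2).2
  have m1 : mellin (fun t => (1/2:ℂ) • ((ee (α * t) : ℝ):ℂ)) s =
      1/2 * (α:ℂ)^(-s) * (Complex.Gamma s * riemannZeta s) := by
    rw [mellin_const_smul, mellin_comp_mul_left (fun t => (ee t : ℂ)) s hα, ee_mellin h0]
    simp only [smul_eq_mul]; ring
  have m2 : mellin (fun t : ℝ => (1/(α:ℂ)) • ((t:ℂ)^(-1:ℂ) • (kk t : ℂ))) s =
      (1/(α:ℂ)) * (Complex.Gamma (s-1) * riemannZeta (s-1)) := by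
    rw [mellin_const_smul, mellin_cpow_smul, kk_mellin r1 r2]
    simp only [smul_eq_mul, ← sub_eq_add_neg]
  rw [m1, m2] at h
  rw [← h]
  congr 1
  ext t
  unfold JJ
  rw [cpow_neg_one]
  push_cast
  simp only [smul_eq_mul]
  rw [div_eq_mul_inv (kk t : ℂ), mul_inv]
  ring

lemma JJ_lim {α : ℝ} (hα : 0 < α) :
    mellin (fun t => (JJ α t : ℂ)) 1 =
      (1/(α:ℂ)) * (1/2 * Real.eulerMascheroniConstant - 1/2 * Real.log α - 1/2 * Real.log (2 * Real.pi)) := by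
  have hα' : (α:ℂ) ≠ 0 := by exact_mod_cast hα.ne'
  have hl : Tendsto (fun ε : ℝ => (ε:ℂ)) (𝓝[>] 0) (𝓝[≠] 0) := by
    refine tendsto_nhdsWithin_iff.mpr ⟨?_, ?_⟩
    · have : Tendsto (fun ε : ℝ => (ε:ℂ)) (𝓝 0) (𝓝 ((0:ℝ):ℂ)) := continuous_ofReal.tendsto 0
      simpa using this.mono_left nhdsWithin_le_nhds
    · filter_upwards [self_mem_nhdsWithin] with t ht
      have ht : 0 < t := ht
      simpa using ht.ne'
  have t1 : Tendsto (fun ε : ℝ => mellin (fun t => (JJ α t : ℂ)) (1 + (ε:ℂ))) (𝓝[>] 0)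
      (𝓝 (mellin (fun t => (JJ α t : ℂ)) 1)) := by
    have hc := (JJ_diff hα (s := 1) (by simp) (by simp)).continuousAt
    have : Tendsto (fun w : ℂ => 1 + w) (𝓝[≠] 0) (𝓝 1) := by
      have : Tendsto (fun w : ℂ => 1 + w) (𝓝 0) (𝓝 (1+0)) := by
        exact (continuous_const.add continuous_id).tendsto 0
      rw [add_zero] at this
      exact this.mono_left nhdsWithin_le_nhds
    exact hc.tendsto.comp (this.comp hl)
  let G : ℂ → ℂ := fun w => (1/(α:ℂ)) * Complex.Gamma (1 + w) *
    (1/2 * (α:ℂ)^(-w) * riemannZeta₀ (1 + w) + 1/2 * (w⁻¹ * ((α:ℂ)^(-w) - 1))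
      + w⁻¹ * (riemannZeta w + 1/2))
  have hadd : Tendsto (fun w : ℂ => 1 + w) (𝓝 0) (𝓝 1) := by
    have : Tendsto (fun w : ℂ => 1 + w) (𝓝 0) (𝓝 (1+0)) :=
      (continuous_const.add continuous_id).tendsto 0
    rwa [add_zero] at this
  have hpow : HasDerivAt (fun w : ℂ => (α:ℂ)^(-w)) (-(Real.log α : ℂ)) 0 := by
    have := ((hasDerivAt_id (0:ℂ)).neg).const_cpow (c := (α:ℂ)) (Or.inl hα')
    simpa [ofReal_log hα.le] using this
  have g1 : Tendsto (fun w : ℂ => Complex.Gamma (1 + w)) (𝓝[≠] 0) (𝓝 1) := by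
    have h : ContinuousAt Complex.Gamma 1 := by
      refine (differentiableAt_Gamma 1 (fun m h => ?_)).continuousAt
      have := congrArg re h
      simp at this
      have hm : (0:ℝ) ≤ m := Nat.cast_nonneg m
      linarith
    have h' := h.tendsto.comp hadd
    rw [Complex.Gamma_one] at h'
    exact h'.mono_left nhdsWithin_le_nhds
  have g2 : Tendsto (fun w : ℂ => (α:ℂ)^(-w)) (𝓝[≠] 0) (𝓝 1) := by
    have := hpow.continuousAt.tendsto
    simp only [neg_zero, cpow_zero] at this
    exact this.mono_left nhdsWithin_le_nhds
  have g3 : Tendsto (fun w : ℂ => riemannZeta₀ (1 + w)) (𝓝[≠] 0) (𝓝 (Real.eulerMascheroniConstant:ℂ)) := by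
    have h' := (differentiable_riemannZeta₀.continuous.tendsto 1).comp hadd
    rw [riemannZeta₀_one] at h'
    exact h'.mono_left nhdsWithin_le_nhds
  have g4 : Tendsto (fun w : ℂ => w⁻¹ * ((α:ℂ)^(-w) - 1)) (𝓝[≠] 0) (𝓝 (-(Real.log α : ℂ))) := by
    have := hasDerivAt_iff_tendsto_slope_zero.mp hpow
    simpa using this
  have g5 : Tendsto (fun w : ℂ => w⁻¹ * (riemannZeta w + 1/2)) (𝓝[≠] 0) (𝓝 (-(Real.log (2*Real.pi) : ℂ)/2)) := by
    have hd : HasDerivAt riemannZeta (-(Real.log (2*Real.pi) : ℂ)/2) 0 := by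
      have := (differentiableAt_riemannZeta (s := 0) (by simp)).hasDerivAt
      rw [deriv_riemannZeta_zero] at this
      rw [ofReal_log (by positivity)]; push_cast
      exact this
    have := hasDerivAt_iff_tendsto_slope_zero.mp hd
    rw [riemannZeta_zero] at this
    refine this.congr (fun w => ?_)
    simp only [smul_eq_mul, zero_add]; ring
  have t2 : Tendsto G (𝓝[≠] 0) (𝓝 ((1/(α:ℂ)) * 1 * (1/2 * 1 * Real.eulerMascheroniConstant
      + 1/2 * (-(Real.log α : ℂ)) + (-(Real.log (2*Real.pi) : ℂ)/2)))) :=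
    (g1.const_mul _).mul (((( g2.const_mul _).mul g3).add (g4.const_mul _)).add g5)
  have t3 : Tendsto (fun ε : ℝ => mellin (fun t => (JJ α t : ℂ)) (1 + (ε:ℂ))) (𝓝[>] 0)
      (𝓝 ((1/(α:ℂ)) * 1 * (1/2 * 1 * Real.eulerMascheroniConstant
      + 1/2 * (-(Real.log α : ℂ)) + (-(Real.log (2*Real.pi) : ℂ)/2)))) := by
    refine (t2.comp hl).congr' ?_
    filter_upwards [Ioo_mem_nhdsGT (one_pos : (0:ℝ) < 1)] with ε hε
    have hw : (ε:ℂ) ≠ 0 := by exact_mod_cast hε.1.ne'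
    rw [JJ_mellin hα (by simpa using hε.1) (by simp; linarith [hε.2]),
      riemannZeta_eq_inv_sub_add (s := 1 + (ε:ℂ)) (by simpa using hw)]
    simp only [Function.comp, G]
    have e1 : Complex.Gamma (1 + (ε:ℂ)) = ε * Complex.Gamma ε := by
      rw [add_comm, Complex.Gamma_add_one _ hw]
    have e2 : (α:ℂ)^(-(1+(ε:ℂ))) = (α:ℂ)⁻¹ * (α:ℂ)^(-(ε:ℂ)) := by
      rw [neg_add, cpow_add _ _ hα', cpow_neg_one]
    rw [e1, e2, add_sub_cancel_left]
    field_simp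
    ring
  rw [tendsto_nhds_unique t1 t3]
  ring

lemma JJ_integral {α : ℝ} (hα : 0 < α) :
    ∫ t in Ioi (0:ℝ), JJ α t = (Real.eulerMascheroniConstant - Real.log (2 * Real.pi * α)) / (2 * α) := by
  have h := JJ_lim hα
  unfold mellin at h
  simp only [sub_self, cpow_zero, one_smul] at h
  rw [integral_complex_ofReal] at h
  rw [Real.log_mul (by positivity) hα.ne']
  have h' : ∫ t in Ioi (0:ℝ), JJ α t = (1/α) * (1/2 * Real.eulerMascheroniConstant - 1/2 * Real.log α - 1/2 * Real.log (2 * Real.pi)) := by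
    apply ofReal_injective
    push_cast
    rw [h]
  rw [h']
  field_simp
  ring

lemma lhs_eq {α : ℝ} (hα : 0 < α) :
    (Real.eulerMascheroniConstant - Real.log (2 * Real.pi * α)) / (2 * α)
        + ∑' n : ℕ+, phi (n * α) = - KK α := by
  rw [sum_phi hα, ← JJ_integral hα]
  have : ∫ t in Ioi (0:ℝ), hh t * ee (α * t) = KK α + ∫ t in Ioi (0:ℝ), JJ α t := by
    unfold KK
    rw [← integral_add (KK_integrable hα) (JJ_int hα)]
    exact setIntegral_congr_fun measurableSet_Ioi (fun t ht => JJ_eq hα ht)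
  rw [this]; ring

lemma xi_eq {s : ℂ} (h0 : s ≠ 0) (hG : Gammaℝ s ≠ 0) :
    RiemannXi s = 1/2 * s * (s - 1) * completedRiemannZeta s := by
  unfold RiemannXi
  rw [riemannZeta_def_of_ne_zero h0]
  have : (Real.pi : ℂ) ^ (-s / 2) * Complex.Gamma (s / 2) = Gammaℝ s := rfl
  rw [show (1/2 * s * (s-1) * (Real.pi : ℂ) ^ (-s / 2) * Complex.Gamma (s / 2) * (completedRiemannZeta s / Gammaℝ s)) = 1/2 * s * (s-1) * ((Real.pi : ℂ) ^ (-s / 2) * Complex.Gamma (s / 2)) * (completedRiemannZeta s / Gammaℝ s) by ring, this]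
  field_simp

lemma core {s : ℂ} (hre : s.re = 1/2) :
    RiemannXi s ^ 2 * Complex.Gamma ((s-1)/2) * Complex.Gamma (-s/2) / (4 * s * (1 - s))
      = 1/2 * (Real.pi:ℂ)^(1/2:ℂ) * ((Complex.Gamma s * riemannZeta s) * (Complex.Gamma (1-s) * riemannZeta (1-s))) := by
  have h0 : s ≠ 0 := by rintro rfl; simp at hre
  have h1 : 1 - s ≠ 0 := by
    intro h; have := congrArg re h; simp at this; linarith
  have hpi : (Real.pi:ℂ) ≠ 0 := by exact_mod_cast Real.pi_ne_zero
  have G0 : Gammaℝ s ≠ 0 := Gammaℝ_ne_zero_of_re_pos (by linarith)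
  have G1 : Gammaℝ (1-s) ≠ 0 := Gammaℝ_ne_zero_of_re_pos (by simp; linarith)
  have sym : RiemannXi (1-s) = RiemannXi s := by
    rw [xi_eq h0 G0, xi_eq h1 G1, completedRiemannZeta_one_sub]; ring
  have sq : RiemannXi s ^ 2 = RiemannXi s * RiemannXi (1-s) := by rw [sym]; ring
  rw [sq]
  have g1 : Complex.Gamma ((s-1)/2) = Complex.Gamma (s/2 + 1/2) / ((s-1)/2) := by
    have hne : (s-1)/2 ≠ 0 := by
      intro h; apply h1; linear_combination (-2) * h
    rw [eq_div_iff hne, mul_comm, ← Complex.Gamma_add_one _ hne]; congr 1; ring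
  have g2 : Complex.Gamma (-s/2) = Complex.Gamma ((1-s)/2 + 1/2) / (-s/2) := by
    have hne : -s/2 ≠ 0 := by
      intro h; apply h0; linear_combination (-2) * h
    rw [eq_div_iff hne, mul_comm, ← Complex.Gamma_add_one _ hne]; congr 1; ring
  have d1 := Complex.Gamma_mul_Gamma_add_half (s/2)
  have d2 := Complex.Gamma_mul_Gamma_add_half ((1-s)/2)
  rw [show 2 * (s/2) = s by ring] at d1
  rw [show 2 * ((1-s)/2) = 1-s by ring] at d2
  have p2 : (2:ℂ)^(1-s) * (2:ℂ)^(1-(1-s)) = 2 := by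
    rw [← cpow_add _ _ two_ne_zero]; simp
  have pp : (Real.pi:ℂ)^(-s/2) * (Real.pi:ℂ)^(-(1-s)/2) * (Real.pi:ℂ)^(1/2:ℂ) = 1 := by
    rw [← cpow_add _ _ hpi, ← cpow_add _ _ hpi]
    rw [show -s/2 + -(1-s)/2 + 1/2 = 0 by ring, cpow_zero]
  have sp : ((Real.sqrt Real.pi : ℝ):ℂ) = (Real.pi:ℂ)^(1/2:ℂ) := by
    rw [Real.sqrt_eq_rpow, ofReal_cpow Real.pi_pos.le]; push_cast; rfl
  rw [sp] at d1 d2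
  unfold RiemannXi
  rw [g1, g2]
  set P := (Real.pi:ℂ)^(1/2:ℂ)
  have hs1 : s - 1 ≠ 0 := by intro h; apply h1; linear_combination -h
  generalize (Real.pi:ℂ)^(-s/2) = A at *
  generalize (Real.pi:ℂ)^(-(1-s)/2) = B at *
  generalize (2:ℂ)^(1-s) = C at *
  generalize (2:ℂ)^(1-(1-s)) = D at *
  have key : Complex.Gamma (s/2) * Complex.Gamma (s/2+1/2) * (Complex.Gamma ((1-s)/2) * Complex.Gamma ((1-s)/2+1/2)) * A * B = 2 * P * (Complex.Gamma s * Complex.Gamma (1-s)) := by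
    rw [d1, d2]
    linear_combination (Complex.Gamma s * Complex.Gamma (1-s)) * (A * B * P^2 * p2 + 2 * P * pp)
  have e : 1/2 * s * (s-1) * A * Complex.Gamma (s/2) * riemannZeta s *
      (1/2 * (1-s) * (1-s-1) * B * Complex.Gamma ((1-s)/2) * riemannZeta (1-s)) *
      (Complex.Gamma (s/2+1/2) / ((s-1)/2)) * (Complex.Gamma ((1-s)/2+1/2) / (-s/2)) / (4 * s * (1-s))
      = 1/4 * (Complex.Gamma (s/2) * Complex.Gamma (s/2+1/2) * (Complex.Gamma ((1-s)/2) * Complex.Gamma ((1-s)/2+1/2)) * A * B) * riemannZeta s * riemannZeta (1-s) := by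
    field_simp
    ring
  rw [e, key]
  ring

lemma integrand_eq (α t : ℝ) :
    (RiemannBigXi (t / 2)) ^ 2 * Complex.Gamma ((-1 + I * t) / 4) *
          Complex.Gamma ((-1 - I * t) / 4) *
          Complex.cos ((t / 2) * Real.log α) / (1 + (t:ℂ) ^ 2)
    = 1/2 * (Real.pi:ℂ)^(1/2:ℂ) * (WW (t/2) * Complex.cos ((t / 2) * Real.log α)) := by
  have h := core (s := 1/2 + I * (t/2)) (by simp)
  unfold RiemannBigXi WW
  rw [show (-1 + I * t) / 4 = (1/2 + I * (t/2) - 1)/2 by ring,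
    show (-1 - I * t) / 4 = -(1/2 + I * ((t:ℂ)/2))/2 by ring]
  have e : 4 * (1/2 + I * ((t:ℂ)/2)) * (1 - (1/2 + I * ((t:ℂ)/2))) = 1 + (t:ℂ)^2 := by
    linear_combination (-(t:ℂ)^2) * I_sq
  rw [e] at h
  have e1 : (1/2 + ((t/2 : ℝ):ℂ) * I) = 1/2 + I * ((t:ℂ)/2) := by push_cast; ring
  have e2 : (1/2 - ((t/2 : ℝ):ℂ) * I) = 1 - (1/2 + I * ((t:ℂ)/2)) := by push_cast; ring
  rw [e1, e2]
  linear_combination (Complex.cos ((t / 2) * Real.log α)) * h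

lemma WW_even (y : ℝ) : WW (-y) = WW y := by
  unfold WW; push_cast
  rw [show (1/2 + -(y:ℂ) * I) = 1/2 - y * I by ring, show (1/2 - -(y:ℂ) * I) = 1/2 + y * I by ring]
  ring

lemma KK_cos {α : ℝ} (hα : 0 < α) :
    (Real.sqrt α : ℂ) * (KK α : ℂ) = (1/(2*Real.pi):ℂ) * ∫ t in Ioi (0:ℝ), WW (t/2) * Complex.cos ((t / 2) * Real.log α) := by
  have hα' : (α:ℂ) ≠ 0 := by exact_mod_cast hα.ne'
  set L := Real.log α with hL
  let F : ℝ → ℂ := fun y => exp (-(y * I * L)) * WW y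
  have hF : ∀ y : ℝ, (α:ℂ)^(-(1/2 + y*I)) * WW y = (Real.sqrt α : ℂ)⁻¹ * F y := by
    intro y
    have sp : ((Real.sqrt α : ℝ):ℂ) = (α:ℂ)^(1/2:ℂ) := by
      rw [Real.sqrt_eq_rpow, ofReal_cpow hα.le]; push_cast; rfl
    rw [sp, neg_add, cpow_add _ _ hα', cpow_neg]
    simp only [F]
    rw [cpow_def_of_ne_zero hα' (-(y*I)), ← ofReal_log hα.le, ← hL]
    rw [show (L:ℂ) * -(y*I) = -(y*I*L) by ring]; ring
  have hs : (Real.sqrt α : ℂ) ≠ 0 := by exact_mod_cast (Real.sqrt_pos.mpr hα).ne'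
  rw [KK_inv hα]
  simp_rw [hF]
  rw [integral_const_mul]
  have Fint : Integrable F := by
    refine WW_int.bdd_mul (c := 1) ?_ ?_
    · exact Continuous.aestronglyMeasurable (by fun_prop)
    · refine Eventually.of_forall fun y => ?_
      rw [norm_exp]; simp
  have split : ∫ y, F y = (∫ y in Ioi (0:ℝ), F y) + ∫ y in Ioi (0:ℝ), F (-y) := by
    rw [integral_comp_neg_Ioi, neg_zero, add_comm, ← setIntegral_union (by
      rw [Set.disjoint_left]; intro x hx hx'; simp at hx hx'; linarith) measurableSet_Ioi Fint.integrableOn Fint.integrableOn]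
    rw [Iic_union_Ioi, setIntegral_univ]
  have two : ∫ y, F y = ∫ y in Ioi (0:ℝ), 2 * (WW y * Complex.cos (y * L)) := by
    rw [split, ← integral_add Fint.integrableOn (Fint.comp_neg).integrableOn]
    refine setIntegral_congr_fun measurableSet_Ioi (fun y _ => ?_)
    simp only [F, WW_even, Complex.cos]
    push_cast
    rw [show -(-(y:ℂ) * I * L) = y * L * I by ring, show -((y:ℂ) * I * L) = -(y * L) * I by ring]
    ring
  have sub : ∫ y in Ioi (0:ℝ), 2 * (WW y * Complex.cos (y * L)) = ∫ t in Ioi (0:ℝ), WW (t/2) * Complex.cos ((t / 2) * L) := by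
    have := integral_comp_mul_left_Ioi (fun y : ℝ => WW y * Complex.cos (y * L)) 0 (b := 1/2) (by norm_num)
    rw [mul_zero] at this
    rw [integral_const_mul]
    have h2 : ∫ t in Ioi (0:ℝ), WW (t/2) * Complex.cos ((t / 2) * L) = ∫ t in Ioi (0:ℝ), (WW (1/2*t) * Complex.cos (((1/2*t:ℝ):ℂ) * L)) := by
      refine setIntegral_congr_fun measurableSet_Ioi (fun t _ => ?_)
      rw [show t/2 = 1/2*t by ring]; push_cast; rw [show (t:ℂ)/2 = 1/2*t by ring]
    rw [h2, this]
    simp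
  rw [two, sub]
  generalize (∫ t in Ioi (0:ℝ), WW (t/2) * Complex.cos ((t / 2) * L)) = Q
  push_cast
  field_simp

/-- Integral representation in Ramanujan's modular relation for the digamma function. -/
theorem ramanujan_digamma_integral (α : ℝ) (hα : 0 < α) :
    ((Real.sqrt α * ((Real.eulerMascheroniConstant - Real.log (2 * Real.pi * α)) / (2 * α)
        + ∑' n : ℕ+, phi (n * α)) : ℝ) : ℂ)
  = -(1 / (Real.pi : ℂ) ^ ((3:ℂ)/2)) *
      ∫ t in Ioi (0:ℝ),
        (RiemannBigXi (t / 2)) ^ 2 * Complex.Gamma ((-1 + I * t) / 4) *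
          Complex.Gamma ((-1 - I * t) / 4) *
          Complex.cos ((t / 2) * Real.log α) / (1 + (t:ℂ) ^ 2) := by

  rw [lhs_eq hα]
  simp_rw [integrand_eq]
  rw [integral_const_mul]
  have h := KK_cos hα
  have hpi : (Real.pi:ℂ) ≠ 0 := by exact_mod_cast Real.pi_ne_zero
  have p : (Real.pi:ℂ)^((3:ℂ)/2) = Real.pi * (Real.pi:ℂ)^(1/2:ℂ) := by
    rw [show (3:ℂ)/2 = 1 + 1/2 by norm_num, cpow_add _ _ hpi, cpow_one]
  have hp : (Real.pi:ℂ)^(1/2:ℂ) ≠ 0 := by simp [cpow_eq_zero_iff, hpi]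
  rw [p]
  push_cast
  rw [mul_neg, h]
  generalize (∫ t in Ioi (0:ℝ), WW (t/2) * Complex.cos ((t / 2) * Real.log α)) = Q
  field_simp
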